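/- Let D be a data set with n ≥ 1 observations on a grid of E ε-bins. Let M_{K>n} be a histogram compatible with D with K > n intervals, each of which is either a singleton interval (h_k = 1) or an empty interval (h_k = 0), with exactly n singleton intervals, E_k ≥ 1 for all k and Σ_k E_k = E. Let M_{K=1} be the histogram compatible with D with a single interval. Then c_Enum(M_{K>n}|D) > c_Enum(M_{K=1}|D); equivalently, log*(K) + log C(E+K−1, K−1) + log C(n+K−1, K−1) + log(n!) + Σ_{k: h_k=1} log E_k > log*(1) + n log E. -/

import Mathlib

open Real Finset

/-- Rissanen's universal code length for integers:
`log*(K) = log₂(2.865) + Σ_{j≥1} max(log₂^{(j)}(K), 0)`. -/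
noncomputable def logStar (K : ℕ) : ℝ :=
  Real.logb 2 2.865 + ∑' j : ℕ, max ((fun x => Real.logb 2 x)^[j + 1] (K : ℝ)) 0

/-- A histogram model on the ε-grid built on the data range `[xmin, xmax]`,
with `E` elementary ε-bins.  Intervals are `]c k, c (k+1)]` for `k < K`, with
count `h k`; the counts sum to `n`. -/
structure Histogram (n : ℕ) (ε xmin xmax : ℝ) (E : ℕ) where
  K : ℕ
  c : ℕ → ℝ
  h : ℕ → ℕ
  K_pos : 1 ≤ K
  c_mono : ∀ k < K, c k ≤ c (k + 1)
  c_first : c 0 = xmin - ε / 2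
  c_last : c K = xmax + ε / 2
  c_grid : ∀ k ≤ K, ∃ t : ℕ, t ≤ E ∧ c k = xmin - ε / 2 + t * ε
  h_sum : ∑ k ∈ Finset.range K, h k = n

namespace Histogram

variable {n : ℕ} {ε xmin xmax : ℝ} {E : ℕ}

open Classical in
/-- Compatibility of a histogram with a data set: the count of each
interval matches the number of observations that fall in it. -/
def Compatible (D : Fin n → ℝ) (M : Histogram n ε xmin xmax E) : Prop :=
  ∀ k < M.K,
    (Finset.univ.filter fun i => D i ∈ Set.Ioc (M.c k) (M.c (k + 1))).card = M.h k

/-- The Enum MDL criterion for histogram selection. -/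
noncomputable def cEnum (M : Histogram n ε xmin xmax E) : ℝ :=
  logStar M.K + Real.log (Nat.choose (E + M.K - 1) (M.K - 1))
    + Real.log (Nat.choose (n + M.K - 1) (M.K - 1))
    + (Real.log (Nat.factorial n)
        - ∑ k ∈ Finset.range M.K, Real.log (Nat.factorial (M.h k)))
    + ∑ k ∈ Finset.range M.K, (M.h k : ℝ) * Real.log ((M.c (k + 1) - M.c k) / ε)

/-- A histogram is optimal for `D` if it is compatible with `D` and minimizes
the Enum criterion among all compatible histograms on the same grid. -/
def Optimal (D : Fin n → ℝ) (M : Histogram n ε xmin xmax E) : Prop :=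
  M.Compatible D ∧
    ∀ M' : Histogram n ε xmin xmax E, M'.Compatible D → M.cEnum ≤ M'.cEnum

end Histogram


theorem logStar_one_le (K : ℕ) : logStar 1 ≤ logStar K := by
  have h1 : ∀ j : ℕ, (fun x => Real.logb 2 x)^[j + 1] ((1 : ℕ) : ℝ) = 0 := by
    intro j
    induction j with
    | zero => simp
    | succ j ih => rw [Function.iterate_succ_apply', ih]; simp
  unfold logStar
  simp only [h1, max_self, tsum_zero, add_zero]
  have : 0 ≤ ∑' j : ℕ, max ((fun x => Real.logb 2 x)^[j + 1] (K : ℝ)) 0 :=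
    tsum_nonneg fun j => le_max_right _ _
  linarith

theorem pow_lt_choose_mul (E n K : ℕ) (hn : 1 ≤ n) (hK : n < K) :
    E ^ n < Nat.choose (E + K - 1) (K - 1) * Nat.factorial n := by
  have h1 : Nat.choose (E + n) n ≤ Nat.choose (E + K - 1) (K - 1) := by
    have e : E + K - 1 = E + (K - 1) := by omega
    rw [e, ← Nat.choose_symm_add, ← Nat.choose_symm_add]
    exact Nat.choose_le_choose _ (by omega)
  have h2 : E ^ n < (E + 1).ascFactorial n :=
    lt_of_lt_of_le (Nat.pow_lt_pow_left (Nat.lt_succ_self E) (by omega))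
      (Nat.pow_succ_le_ascFactorial _ _)
  rw [Nat.ascFactorial_eq_factorial_mul_choose] at h2
  calc E ^ n < _ := h2
    _ = Nat.choose (E + n) n * Nat.factorial n := mul_comm _ _
    _ ≤ _ := Nat.mul_le_mul_right _ h1

/-- the single-interval histogram has a strictly shorter coding
length than any histogram with `K > n` intervals that are all singleton or
empty, with exactly `n` singleton intervals. -/
theorem stmt2 {n : ℕ} {ε xmin xmax : ℝ} {E : ℕ} (D : Fin n → ℝ)
    (hn : 1 ≤ n) (hε : 0 < ε)
    (hxmin : IsGLB (Set.range D) xmin) (hxmax : IsLUB (Set.range D) xmax)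
    (hE1 : 1 ≤ E) (hE : (E : ℝ) = 1 + (xmax - xmin) / ε)
    (M : Histogram n ε xmin xmax E) (hM : M.Compatible D)
    (hKn : n < M.K) (hh01 : ∀ k < M.K, M.h k = 0 ∨ M.h k = 1)
    (hcard : ((Finset.range M.K).filter fun k => M.h k = 1).card = n)
    (hw : ∀ k < M.K, 1 ≤ (M.c (k + 1) - M.c k) / ε)
    (M1 : Histogram n ε xmin xmax E) (hM1 : M1.Compatible D) (hK1 : M1.K = 1) :
    M1.cEnum < M.cEnum ∧
    logStar 1 + (n : ℝ) * Real.log (E : ℝ) <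
      logStar M.K + Real.log (Nat.choose (E + M.K - 1) (M.K - 1))
        + Real.log (Nat.choose (n + M.K - 1) (M.K - 1)) + Real.log (Nat.factorial n)
        + ∑ k ∈ (Finset.range M.K).filter (fun k => M.h k = 1),
            Real.log ((M.c (k + 1) - M.c k) / ε) := by
  have key : logStar 1 + (n : ℝ) * Real.log (E : ℝ) <
      logStar M.K + Real.log (Nat.choose (E + M.K - 1) (M.K - 1))
        + Real.log (Nat.choose (n + M.K - 1) (M.K - 1)) + Real.log (Nat.factorial n)
        + ∑ k ∈ (Finset.range M.K).filter (fun k => M.h k = 1),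
            Real.log ((M.c (k + 1) - M.c k) / ε) := by
    have a := logStar_one_le M.K
    have b : (n : ℝ) * Real.log (E : ℝ) <
        Real.log (Nat.choose (E + M.K - 1) (M.K - 1)) + Real.log (Nat.factorial n) := by
      have c1 : 0 < Nat.choose (E + M.K - 1) (M.K - 1) := Nat.choose_pos (by omega)
      have c2 := Nat.factorial_pos n
      rw [← Real.log_pow, ← Real.log_mul (by positivity) (by positivity)]
      apply Real.log_lt_log
      · have : (0 : ℝ) < E := by exact_mod_cast hE1
        positivity
      · exact_mod_cast pow_lt_choose_mul E n M.K hn hKn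
    have d : 0 ≤ Real.log (Nat.choose (n + M.K - 1) (M.K - 1)) := Real.log_natCast_nonneg _
    have e : 0 ≤ ∑ k ∈ (Finset.range M.K).filter (fun k => M.h k = 1),
            Real.log ((M.c (k + 1) - M.c k) / ε) := by
      apply Finset.sum_nonneg
      intro k hk
      exact Real.log_nonneg (hw k (Finset.mem_range.1 (Finset.mem_filter.1 hk).1))
    linarith
  refine ⟨?_, key⟩
  have e1 : M1.cEnum = logStar 1 + (n : ℝ) * Real.log (E : ℝ) := by
    have hs := M1.h_sum
    have hl := M1.c_last
    have hf := M1.c_first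
    rw [hK1] at hs hl
    simp only [Finset.sum_range_one] at hs
    have hq : (M1.c 1 - M1.c 0) / ε = E := by
      rw [hl, hf, hE]; field_simp; ring
    unfold Histogram.cEnum
    rw [hK1]
    simp [hs, hq]
  have e2 : ∑ k ∈ Finset.range M.K, Real.log (Nat.factorial (M.h k)) = 0 := by
    apply Finset.sum_eq_zero
    intro k hk
    rcases hh01 k (Finset.mem_range.1 hk) with h | h <;> simp [h]
  have e3 : ∑ k ∈ Finset.range M.K, (M.h k : ℝ) * Real.log ((M.c (k + 1) - M.c k) / ε)
      = ∑ k ∈ (Finset.range M.K).filter (fun k => M.h k = 1),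
            Real.log ((M.c (k + 1) - M.c k) / ε) := by
    rw [Finset.sum_filter]
    apply Finset.sum_congr rfl
    intro k hk
    rcases hh01 k (Finset.mem_range.1 hk) with h | h <;> simp [h]
  rw [e1]
  unfold Histogram.cEnum
  rw [e2, e3]
  linarith
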